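/- With S as in situation (6), faces τ, and vectors α ∈ K^d, a ∈ ℤ^d: one has 𝕀(τ) + α ≼_S 𝕀(τ) + α + a (i.e., 𝕀(Ω_S(a)) ⊄ 𝕀(α + Kτ)) if and only if (i) for all facets σ ⊇ τ, F_σ(α) ∈ F_σ(S_c) implies F_σ(α + a) ∈ F_σ(S_c), and (ii) for all faces τ_i ⊇ τ (from the standard expression), α + a − b_i ∈ Kτ_i implies b_i − a ∉ S + ℤ(A∩τ_i). -/

import Mathlib

open Function

/-- Lattice `ℤ^d`. -/
abbrev Zd (d : ℕ) := Fin d → ℤ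

noncomputable section

namespace SaitoTakahashi

variable {d : ℕ}

/-- The affine semigroup `ℕA` generated by the finite set `A ⊆ ℤ^d`. -/
def NA (A : Finset (Zd d)) : AddSubmonoid (Zd d) := AddSubmonoid.closure (A : Set (Zd d))

/-- The group `ℤA` generated by `A`. -/
def ZA (A : Finset (Zd d)) : AddSubgroup (Zd d) := AddSubgroup.closure (A : Set (Zd d))

/-- Realification of a lattice point. -/
def toR (a : Zd d) : Fin d → ℝ := fun i => (a i : ℝ)

/-- The real cone `ℝ≥0 A`. -/
def coneOf (A : Finset (Zd d)) : Set (Fin d → ℝ) :=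
  { x | ∃ c : Zd d → ℝ, (∀ a, 0 ≤ c a) ∧ x = ∑ a ∈ A, c a • toR a }

/-- The cone `ℝ≥0 A` is strongly convex. -/
def StronglyConvex (A : Finset (Zd d)) : Prop :=
  ∀ x ∈ coneOf A, -x ∈ coneOf A → x = 0

/-- `B = A ∩ τ` for a face `τ` of the cone `ℝ≥0 A`, i.e. `B` is the subset of `A`
cut out by an integral supporting functional which is nonnegative on `A`. -/
def IsFace (A B : Finset (Zd d)) : Prop :=
  ∃ G : Zd d →+ ℤ, B ⊆ A ∧ (∀ a ∈ A, 0 ≤ G a) ∧ ∀ a ∈ A, (G a = 0 ↔ a ∈ B)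

/-- `F` is the primitive integral support function of a facet of `ℝ≥0 A`:
nonnegative on the cone, surjective onto `ℤ` (primitivity, using `ℤA = ℤ^d`),
and its zero set in the cone is a face of dimension `d - 1`. -/
def IsFacetFn (A : Finset (Zd d)) (F : Zd d →+ ℤ) : Prop :=
  (∀ a ∈ A, 0 ≤ F a) ∧ Surjective F ∧
    Module.finrank ℝ ↥(Submodule.span ℝ (toR '' {a : Zd d | a ∈ A ∧ F a = 0})) = d - 1

/-- The set `A ∩ σ` for the facet with primitive integral support function `F`. -/
def facetSet (A : Finset (Zd d)) (F : Zd d →+ ℤ) : Finset (Zd d) :=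
  A.filter fun a => F a = 0

/-- `S` is an `ℕA`-set: `S + ℕA ⊆ S`. -/
def IsNASet (A : Finset (Zd d)) (S : Set (Zd d)) : Prop :=
  ∀ s ∈ S, ∀ a ∈ NA A, s + a ∈ S

/-- `S` is a finitely generated `ℕA`-set. -/
def IsFGNASet (A : Finset (Zd d)) (S : Set (Zd d)) : Prop :=
  IsNASet A S ∧ ∃ G : Finset (Zd d), S = { x | ∃ g ∈ G, ∃ a ∈ NA A, x = g + a }

/-- `S` is scored: `S = ⋂_{σ facet} { a ∈ ℤ^d : F_σ(a) ∈ F_σ(S) }`. -/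
def IsScored (A : Finset (Zd d)) (S : Set (Zd d)) : Prop :=
  S = { x : Zd d | ∀ F : Zd d →+ ℤ, IsFacetFn A F → F x ∈ F '' S }

/-- `S + ℤ(A ∩ τ)` where `B = A ∩ τ`. -/
def plusZ (S : Set (Zd d)) (B : Finset (Zd d)) : Set (Zd d) :=
  { x | ∃ s ∈ S, ∃ z ∈ AddSubgroup.closure (B : Set (Zd d)), x = s + z }

/-- The coset `b + ℤ(A ∩ τ)` where `B = A ∩ τ`. -/
def coset (b : Zd d) (B : Finset (Zd d)) : Set (Zd d) :=
  { x | x - b ∈ AddSubgroup.closure (B : Set (Zd d)) }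

/-- The standard-expression setting of the paper:
`S = S_c \ ⋃ᵢ (bᵢ + ℤ(A∩τᵢ))`, where `S_c` is a finitely generated scored
`ℕA`-set (the scored closure of `S`), `bᵢ ∈ S_c`, the `τᵢ` are faces of `ℝ≥0 A`
(encoded by `Bf i = A ∩ τᵢ`), and `F_σ(S) = F_σ(S_c)` for every facet `σ`. -/
structure Setting (A : Finset (Zd d)) (Sc S : Set (Zd d)) {m : ℕ}
    (b : Fin m → Zd d) (Bf : Fin m → Finset (Zd d)) : Prop where
  latt : ZA A = ⊤
  convex : StronglyConvex A
  fg : IsFGNASet A Sc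
  scored : IsScored A Sc
  bIn : ∀ i, b i ∈ Sc
  face : ∀ i, IsFace A (Bf i)
  expr : S = Sc \ ⋃ i, coset (b i) (Bf i)
  sameF : ∀ F : Zd d →+ ℤ, IsFacetFn A F → F '' S = F '' Sc

/-- The expression `S = S_c \ ⋃ᵢ (bᵢ + ℤ(A∩τᵢ))` is irredundant. -/
def Irredundant (Sc S : Set (Zd d)) {m : ℕ}
    (b : Fin m → Zd d) (Bf : Fin m → Finset (Zd d)) : Prop :=
  ∀ i, Sc \ ⋃ j, ⋃ (_ : j ≠ i), coset (b j) (Bf j) ≠ S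

section Kside

variable (K : Type) [Field K]

/-- A lattice point as a point of `K^d`. -/
def toK (a : Zd d) : Fin d → K := fun i => (a i : K)

/-- The vanishing ideal `𝕀(V) ⊆ K[s₁,…,s_d]` of a subset `V ⊆ K^d`. -/
def vIdeal (V : Set (Fin d → K)) : Ideal (MvPolynomial (Fin d) K) :=
  ⨅ v ∈ V, RingHom.ker (MvPolynomial.eval v)

/-- `Ω_{S,S'}(a) = S \ (−a + S')`. -/
def Omega (S S' : Set (Zd d)) (a : Zd d) : Set (Zd d) := S \ { x | a + x ∈ S' }

/-- The `K`-algebra map `f(s) ↦ f(s − c)`. -/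
def shiftHom (c : Fin d → K) : MvPolynomial (Fin d) K →+* MvPolynomial (Fin d) K :=
  MvPolynomial.eval₂Hom MvPolynomial.C (fun i => MvPolynomial.X i - MvPolynomial.C (c i))

/-- The translate `I + c = { f(s − c) : f ∈ I }` of an ideal of `K[s]`. -/
def shiftIdeal (I : Ideal (MvPolynomial (Fin d) K)) (c : Fin d → K) :
    Ideal (MvPolynomial (Fin d) K) :=
  I.map (shiftHom K c)

/-- The `K`-span `Kτ` of a face, where `B = A ∩ τ`. -/
def spanK (B : Finset (Zd d)) : Submodule K (Fin d → K) :=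
  Submodule.span K (toK K '' (B : Set (Zd d)))

/-- `lam` is (a representative of) an element of `E(S)_τ(α)`:
`lam ∈ Kτ` and `α − lam ∈ S + ℤ(A∩τ)`, where `B = A ∩ τ`. -/
def memE (S : Set (Zd d)) (B : Finset (Zd d)) (α lam : Fin d → K) : Prop :=
  lam ∈ spanK K B ∧
    ∃ s ∈ S, ∃ z ∈ AddSubgroup.closure (B : Set (Zd d)), α - lam = toK K s + toK K z

/-- The `K`-linear extension of an integral linear form `F` to `K^d`. -/
def FK (F : Zd d →+ ℤ) (v : Fin d → K) : K :=
  ∑ i, ((F (Pi.single i 1) : ℤ) : K) * v i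

/-- The affine translate `α + Kτ ⊆ K^d`, where `B = A ∩ τ`. -/
def aff (α : Fin d → K) (B : Finset (Zd d)) : Set (Fin d → K) :=
  { x | ∃ lam ∈ spanK K B, x = α + lam }

end Kside

end SaitoTakahashi

namespace SaitoTakahashi

section Aux

variable {d : ℕ} (K : Type) [Field K]

lemma mem_vIdeal {V : Set (Fin d → K)} {f : MvPolynomial (Fin d) K} :
    f ∈ vIdeal K V ↔ ∀ v ∈ V, MvPolynomial.eval v f = 0 := by
  simp [vIdeal, Ideal.mem_iInf, RingHom.mem_ker]

lemma toK_add (x y : Zd d) : toK K (x + y) = toK K x + toK K y := by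
  ext i; simp [toK]

lemma toK_sub (x y : Zd d) : toK K (x - y) = toK K x - toK K y := by
  ext i; simp [toK]

lemma toK_zero : toK K (0 : Zd d) = 0 := by
  ext i; simp [toK]

lemma toK_neg (x : Zd d) : toK K (-x) = -toK K x := by
  ext i; simp [toK]

/-- linear extension as a linear map -/
def FKl (F : Zd d →+ ℤ) : (Fin d → K) →ₗ[K] K where
  toFun := FK K F
  map_add' x y := by simp [FK, mul_add, Finset.sum_add_distrib]
  map_smul' c x := by
    simp only [FK, Pi.smul_apply, smul_eq_mul, RingHom.id_apply, Finset.mul_sum]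
    exact Finset.sum_congr rfl fun i _ => by ring

lemma FKl_apply (F : Zd d →+ ℤ) (v : Fin d → K) : FKl K F v = FK K F v := rfl

lemma FK_toK (F : Zd d →+ ℤ) (x : Zd d) : FK K F (toK K x) = (F x : K) := by
  have h : F x = ∑ i, F (Pi.single i 1) * x i := by
    conv_lhs => rw [← Finset.univ_sum_single x]
    rw [map_sum]
    refine Finset.sum_congr rfl fun i _ => ?_
    have : (Pi.single i (x i) : Zd d) = x i • Pi.single i 1 := by
      rw [← Pi.single_smul]; simp
    rw [this, map_zsmul, smul_eq_mul, mul_comm]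
  rw [h]; simp [FK, toK]

/-- polynomial of an affine form -/
def linPoly (l : (Fin d → K) →ₗ[K] K) (c : K) : MvPolynomial (Fin d) K :=
  ∑ i, MvPolynomial.C (l (Pi.single i 1)) * MvPolynomial.X i - MvPolynomial.C c

lemma eval_linPoly (l : (Fin d → K) →ₗ[K] K) (c : K) (v : Fin d → K) :
    MvPolynomial.eval v (linPoly K l c) = l v - c := by
  have h : l v = ∑ i, l (Pi.single i 1) * v i := by
    conv_lhs => rw [← Finset.univ_sum_single v]
    rw [map_sum]
    refine Finset.sum_congr rfl fun i _ => ?_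
    have : (Pi.single i (v i) : Fin d → K) = v i • Pi.single i 1 := by
      rw [← Pi.single_smul]; simp
    rw [this, map_smul, smul_eq_mul, mul_comm]
  rw [h]; simp [linPoly]

/-- restriction of polynomials to the parametrized affine space -/
def paramHom (α : Fin d → K) (B : Finset (Zd d)) :
    MvPolynomial (Fin d) K →ₐ[K] MvPolynomial B K :=
  MvPolynomial.aeval fun i => MvPolynomial.C (α i) +
    ∑ b : B, MvPolynomial.C (toK K b.1 i) * MvPolynomial.X b

lemma eval_paramHom (α : Fin d → K) (B : Finset (Zd d)) (f : MvPolynomial (Fin d) K)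
    (t : B → K) : MvPolynomial.eval t (paramHom K α B f) =
      MvPolynomial.eval (α + ∑ b : B, t b • toK K b.1) f := by
  induction f using MvPolynomial.induction_on with
  | C c => simp [paramHom]
  | add p q hp hq => simp [hp, hq]
  | mul_X p i hp =>
    rw [map_mul, map_mul, hp, map_mul]
    congr 1
    simp [paramHom, mul_comm]

lemma mem_spanK_iff (B : Finset (Zd d)) (v : Fin d → K) :
    v ∈ spanK K B ↔ ∃ t : B → K, v = ∑ b : B, t b • toK K b.1 := by
  have : toK K '' (B : Set (Zd d)) = Set.range fun b : B => toK K b.1 := by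
    ext; simp
  rw [spanK, this, Submodule.mem_span_range_iff_exists_fun]
  simp [eq_comm]

variable [CharZero K]

lemma vIdeal_aff (α : Fin d → K) (B : Finset (Zd d)) :
    vIdeal K (aff K α B) = RingHom.ker (paramHom K α B) := by
  ext f
  rw [mem_vIdeal, RingHom.mem_ker]
  constructor
  · intro h
    apply MvPolynomial.funext
    intro t
    rw [eval_paramHom, map_zero]
    exact h _ ⟨_, (mem_spanK_iff K B _).2 ⟨t, rfl⟩, rfl⟩
  · rintro h v ⟨l, hl, rfl⟩
    obtain ⟨t, rfl⟩ := (mem_spanK_iff K B l).1 hl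
    rw [← eval_paramHom, h, map_zero]

lemma vIdeal_aff_prime (α : Fin d → K) (B : Finset (Zd d)) :
    (vIdeal K (aff K α B)).IsPrime := by
  rw [vIdeal_aff]
  exact RingHom.ker_isPrime _

lemma dense_NA (x : Zd d) (B : Finset (Zd d)) (f : MvPolynomial (Fin d) K)
    (h : ∀ n ∈ NA B, MvPolynomial.eval (toK K (x + n)) f = 0) :
    f ∈ vIdeal K (aff K (toK K x) B) := by
  rw [vIdeal_aff, RingHom.mem_ker]
  apply MvPolynomial.funext_set (fun _ => Set.range (Nat.cast : ℕ → K))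
    (fun _ => Set.infinite_range_of_injective Nat.cast_injective)
  intro t ht
  have ht' : ∀ b, ∃ n : ℕ, (n : K) = t b := fun b => ht b (Set.mem_univ _)
  choose n hn using ht'
  rw [eval_paramHom, map_zero]
  rw [← h (∑ b : B, n b • b.1)
    (AddSubmonoid.sum_mem _ fun b _ => AddSubmonoid.nsmul_mem _
      (AddSubmonoid.subset_closure b.2) _), toK_add]
  congr 3
  ext i
  simp [toK, ← hn]

lemma toK_mem_spanK {B : Finset (Zd d)} {z : Zd d}
    (hz : z ∈ AddSubgroup.closure (B : Set (Zd d))) : toK K z ∈ spanK K B := by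
  induction hz using AddSubgroup.closure_induction with
  | mem x hx => exact Submodule.subset_span ⟨x, hx, rfl⟩
  | zero => rw [toK_zero]; exact Submodule.zero_mem _
  | add x y _ _ hx hy => rw [toK_add]; exact Submodule.add_mem _ hx hy
  | neg x _ hx => rw [toK_neg]; exact Submodule.neg_mem _ hx

lemma FK_spanK {B : Finset (Zd d)} {G : Zd d →+ ℤ} (hG : ∀ b ∈ B, G b = 0)
    {v : Fin d → K} (hv : v ∈ spanK K B) : FK K G v = 0 := by
  have : spanK K B ≤ LinearMap.ker (FKl K G) := by
    rw [spanK, Submodule.span_le]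
    rintro _ ⟨b, hb, rfl⟩
    simp [FKl_apply, FK_toK, hG b hb]
  exact this hv

lemma NA_le_closure (B : Finset (Zd d)) {n : Zd d} (hn : n ∈ NA B) :
    n ∈ AddSubgroup.closure (B : Set (Zd d)) := by
  have : NA B ≤ (AddSubgroup.closure (B : Set (Zd d))).toAddSubmonoid := by
    rw [NA, AddSubmonoid.closure_le]
    exact AddSubgroup.subset_closure
  exact this hn

lemma dense_S {m : ℕ} {A : Finset (Zd d)} {Sc S : Set (Zd d)}
    {b : Fin m → Zd d} {Bf : Fin m → Finset (Zd d)}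
    (hset : Setting A Sc S b Bf) {B : Finset (Zd d)} (hB : B ⊆ A) {x : Zd d} (hx : x ∈ S)
    (f : MvPolynomial (Fin d) K)
    (h : ∀ n ∈ NA B, x + n ∈ S → MvPolynomial.eval (toK K (x + n)) f = 0) :
    f ∈ vIdeal K (aff K (toK K x) B) := by
  classical
  choose G hG using hset.face
  set g : MvPolynomial (Fin d) K := ∏ j ∈ Finset.univ.filter (fun j => ¬ B ⊆ Bf j),
    linPoly K (FKl K (G j)) (G j (b j) : K) with hg
  have hP := vIdeal_aff_prime K (toK K x) B
  have hx' := hx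
  rw [hset.expr] at hx'
  simp only [Set.mem_diff, Set.mem_iUnion, not_exists] at hx'
  have hfg : f * g ∈ vIdeal K (aff K (toK K x) B) := by
    apply dense_NA
    intro n hn
    rw [map_mul]
    by_cases hS : x + n ∈ S
    · rw [h n hn hS, zero_mul]
    · have hnA : n ∈ NA A := AddSubmonoid.closure_mono (by exact_mod_cast hB) hn
      have hc := hset.fg.1 x hx'.1 n hnA
      rw [hset.expr] at hS
      simp only [Set.mem_diff, hc, true_and, not_not, Set.mem_iUnion] at hS
      obtain ⟨j, hj⟩ := hS
      have hjB : ¬ B ⊆ Bf j := by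
        intro hsub
        apply hx'.2 j
        have h1 : n ∈ AddSubgroup.closure (Bf j : Set (Zd d)) :=
          AddSubgroup.closure_mono (by exact_mod_cast hsub) (NA_le_closure B hn)
        have h2 := AddSubgroup.sub_mem _ hj h1
        have h3 : x + n - b j - n = x - b j := by abel
        rw [h3] at h2
        exact h2
      rw [hg, map_prod, Finset.prod_eq_zero (i := j) (by simp [hjB]), mul_zero]
      rw [eval_linPoly, FKl_apply, FK_toK]
      have h0 : FK K (G j) (toK K (x + n - b j)) = 0 :=
        FK_spanK K (fun c hc => ((hG j).2.2 c ((hG j).1 hc)).2 hc) (toK_mem_spanK K hj)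
      rw [FK_toK, map_sub] at h0
      push_cast at h0
      exact h0
  rcases hP.mem_or_mem hfg with h1 | h1
  · exact h1
  · exfalso
    rw [hg, Ideal.IsPrime.prod_mem_iff] at h1
    obtain ⟨j, hj, h1⟩ := h1
    simp only [Finset.mem_filter, Finset.mem_univ, true_and] at hj
    obtain ⟨c, hc, hcj⟩ := Finset.not_subset.1 hj
    rw [mem_vIdeal] at h1
    have e1 := h1 (toK K x) ⟨0, Submodule.zero_mem _, by simp⟩
    have e2 := h1 (toK K x + toK K c) ⟨_, Submodule.subset_span ⟨c, hc, rfl⟩, rfl⟩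
    rw [eval_linPoly] at e1 e2
    rw [map_add, FKl_apply, FKl_apply, FK_toK, FK_toK] at e2
    rw [FKl_apply, FK_toK] at e1
    have e3 : ((G j c : ℤ) : K) = 0 := by linear_combination e2 - e1
    exact hcj (((hG j).2.2 c (hB hc)).1 (by exact_mod_cast e3))

lemma finrank_spanK_le (L : Type) [Field L] [CharZero L] (B : Finset (Zd d)) :
    Module.finrank K (spanK K B) ≤ Module.finrank L (spanK L B) := by
  have hr : ∀ (M : Type) [Field M], toK M '' (B : Set (Zd d)) =
      Set.range fun b : B => toK M b.1 := by
    intro M _; ext; simp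
  obtain ⟨κ, e, he, hsp, hli⟩ := exists_linearIndependent' K (fun b : B => toK K b.1)
  have : Finite κ := Finite.of_injective e he
  have := Fintype.ofFinite κ
  have hZ : LinearIndependent ℤ (fun k => (e k).1) :=
    linearIndependent_algebraMap_comp_iff (R := ℤ) (S := K).1 hli
  have hL : LinearIndependent L (fun k => toK L (e k).1) :=
    linearIndependent_algebraMap_comp_iff (R := ℤ) (S := L).2 hZ
  rw [spanK, hr K, ← hsp, finrank_span_eq_card hli, ← finrank_span_eq_card hL]
  apply Submodule.finrank_mono
  rw [spanK, hr L]
  apply Submodule.span_mono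
  rintro _ ⟨k, rfl⟩
  exact ⟨e k, rfl⟩

lemma spanK_facet {A : Finset (Zd d)} {F : Zd d →+ ℤ} (hF : IsFacetFn A F) :
    spanK K (facetSet A F) = LinearMap.ker (FKl K F) := by
  obtain ⟨h0, hs, hr⟩ := hF
  have hr' : Module.finrank ℝ (spanK ℝ (facetSet A F)) = d - 1 := by
    rw [← hr]
    have : ((facetSet A F : Finset (Zd d)) : Set (Zd d)) = {a : Zd d | a ∈ A ∧ F a = 0} := by
      ext; simp [facetSet]
    rw [spanK, this]; rfl
  apply Submodule.eq_of_le_of_finrank_le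
  · intro v hv
    exact FK_spanK K (fun c hc => (Finset.mem_filter.1 hc).2) hv
  · obtain ⟨x, hx⟩ := hs 1
    have hsurj : LinearMap.range (FKl K F) = ⊤ := by
      rw [LinearMap.range_eq_top]
      intro c
      refine ⟨c • toK K x, ?_⟩
      rw [map_smul, FKl_apply, FK_toK, hx]; simp
    have := LinearMap.finrank_range_add_finrank_ker (FKl K F)
    rw [hsurj] at this
    simp at this
    have := finrank_spanK_le ℝ K (facetSet A F)
    omega

lemma facets_finite {A : Finset (Zd d)} (hA : ZA A = ⊤) :
    {F : Zd d →+ ℤ | IsFacetFn A F}.Finite := by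
  apply Set.Finite.of_finite_image (f := facetSet A)
  · apply Set.Finite.subset (A.powerset.finite_toSet)
    rintro _ ⟨F, _, rfl⟩
    exact Finset.mem_coe.2 (Finset.mem_powerset.2 (Finset.filter_subset _ _))
  · intro F hF F' hF' he
    have hk : ∀ x, F x = 0 → F' x = 0 := by
      intro x hx
      have h1 := spanK_facet ℚ hF
      have h2 := spanK_facet ℚ hF'
      rw [he, h2] at h1
      have h3 : toK ℚ x ∈ LinearMap.ker (FKl ℚ F) := by
        simp [FKl_apply, FK_toK, hx]
      rw [← h1] at h3
      simpa [FKl_apply, FK_toK] using h3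
    obtain ⟨e, he1⟩ := hF.2.1 1
    have hm : ∀ x, F' x = F x * F' e := by
      intro x
      have := hk (x - F x • e) (by rw [map_sub, map_zsmul, he1]; simp)
      rw [map_sub, map_zsmul, smul_eq_mul] at this
      linarith
    obtain ⟨y, hy⟩ := hF'.2.1 1
    have hu : IsUnit (F' e) := by
      apply IsUnit.of_mul_eq_one (F y)
      rw [mul_comm, ← hm, hy]
    rcases Int.isUnit_iff.1 hu with h | h
    · exact DFunLike.ext _ _ fun x => by rw [hm x, h, mul_one]
    · exfalso
      have hz : ZA A ≤ F.ker := by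
        rw [ZA, AddSubgroup.closure_le]
        intro c hc
        have h1 := hF.1 c hc
        have h2 := hF'.1 c hc
        rw [hm, h] at h2
        show F c = 0
        linarith
      rw [hA] at hz
      have : F e = 0 := hz (AddSubgroup.mem_top e)
      omega

lemma bad_finite {A : Finset (Zd d)} (hA : ZA A = ⊤) {Sc : Set (Zd d)} (hfg : IsFGNASet A Sc)
    {F : Zd d →+ ℤ} (hF : IsFacetFn A F) (c : ℤ) :
    {k : ℤ | k ∈ F '' Sc ∧ k + c ∉ F '' Sc}.Finite := by
  obtain ⟨hNA, G, hG⟩ := hfg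
  have hpos : ∀ n ∈ NA A, 0 ≤ F n := by
    intro n hn
    induction hn using AddSubmonoid.closure_induction with
    | mem x hx => exact hF.1 x hx
    | zero => simp
    | add x y _ _ hx hy => rw [map_add]; omega
  -- every lattice point is a difference
  have hdiff : ∀ x : Zd d, ∃ p ∈ NA A, ∃ q ∈ NA A, x = p - q := by
    intro x
    have hx : x ∈ ZA A := by rw [hA]; trivial
    induction hx using AddSubgroup.closure_induction with
    | mem x hx => exact ⟨x, AddSubmonoid.subset_closure hx, 0, zero_mem _, by simp⟩
    | zero => exact ⟨0, zero_mem _, 0, zero_mem _, by simp⟩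
    | add x y _ _ hx hy =>
      obtain ⟨p, hp, q, hq, rfl⟩ := hx
      obtain ⟨p', hp', q', hq', rfl⟩ := hy
      exact ⟨p + p', add_mem hp hp', q + q', add_mem hq hq', by abel⟩
    | neg x _ hx =>
      obtain ⟨p, hp, q, hq, rfl⟩ := hx
      exact ⟨q, hq, p, hp, by abel⟩
  obtain ⟨e, he⟩ := hF.2.1 1
  obtain ⟨p, hp, q, hq, rfl⟩ := hdiff e
  rw [map_sub] at he
  have hlarge : ∀ n : ℤ, F q * F q ≤ n → ∃ y ∈ NA A, F y = n := by
    intro n hn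
    have hq0 := hpos q hq
    rcases hq0.eq_or_lt with h | h
    · rw [← h] at hn he
      refine ⟨n.toNat • p, AddSubmonoid.nsmul_mem _ hp _, ?_⟩
      rw [map_nsmul, nsmul_eq_mul]
      have : F p = 1 := by omega
      rw [this]; simp; simpa using hn
    · have h1 := Int.emod_nonneg n h.ne'
      have h2 := Int.emod_lt_of_pos n h
      have h3 := Int.mul_ediv_add_emod n (F q)
      have h4 : F q ≤ n / F q := (Int.le_ediv_iff_mul_le h).2 hn
      refine ⟨(n / F q - n % F q).toNat • q + (n % F q).toNat • p,
        add_mem (AddSubmonoid.nsmul_mem _ hq _) (AddSubmonoid.nsmul_mem _ hp _), ?_⟩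
      rw [map_add, map_nsmul, map_nsmul, nsmul_eq_mul, nsmul_eq_mul]
      rw [Int.toNat_of_nonneg (by omega), Int.toNat_of_nonneg h1]
      have : F p = F q + 1 := by omega
      rw [this]
      linear_combination h3
  by_cases hne : Sc.Nonempty
  · obtain ⟨s, hs⟩ := hne
    obtain ⟨lo, hlo⟩ := (G.image F).bddBelow
    apply Set.Finite.subset (Set.finite_Icc lo (F s + F q * F q - c))
    rintro k ⟨⟨y, hy, rfl⟩, hk⟩
    constructor
    · rw [hG] at hy
      obtain ⟨g, hg, n, hn, rfl⟩ := hy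
      have h1 : lo ≤ F g := hlo (by simpa using ⟨g, hg, rfl⟩)
      have h2 := hpos n hn
      rw [map_add]; omega
    · by_contra hlt
      apply hk
      obtain ⟨z, hz, hz'⟩ := hlarge (F y + c - F s) (by omega)
      exact ⟨s + z, hNA s hs z hz, by rw [map_add, hz']; ring⟩
  · rw [Set.not_nonempty_iff_eq_empty] at hne
    subst hne
    simp

end Aux

/-- Lemma 4.4. `𝕀(τ) + α ≼_S 𝕀(τ) + α + a`, i.e.
`𝕀(Ω_S(a)) ⊄ 𝕀(α + Kτ)`, if and only if (i) for all facets `σ ⊇ τ`,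
`F_σ(α) ∈ F_σ(S_c)` implies `F_σ(α + a) ∈ F_σ(S_c)`, and (ii) for all faces
`τᵢ ⊇ τ`, `α + a − bᵢ ∈ Kτᵢ` implies `bᵢ − a ∉ S + ℤ(A∩τᵢ)`. -/
theorem preceq_iff_conditions {d m : ℕ}
    (K : Type) [Field K] [IsAlgClosed K] [CharZero K]
    (A : Finset (Zd d)) (Sc S : Set (Zd d))
    (b : Fin m → Zd d) (Bf : Fin m → Finset (Zd d))
    (hset : Setting A Sc S b Bf)
    (Bτ : Finset (Zd d)) (hτ : IsFace A Bτ)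
    (α : Fin d → K) (a : Zd d) :
    (¬ vIdeal K (toK K '' Omega S S a) ≤ vIdeal K (aff K α Bτ)) ↔
      ((∀ F : Zd d →+ ℤ, IsFacetFn A F → Bτ ⊆ facetSet A F →
          (∃ s ∈ Sc, FK K F α = (F s : K)) →
          ∃ s ∈ Sc, FK K F (α + toK K a) = (F s : K)) ∧
       (∀ i, Bτ ⊆ Bf i →
          (α + toK K a - toK K (b i)) ∈ spanK K (Bf i) →
          b i - a ∉ plusZ S (Bf i))) := by
  classical
  have hP := vIdeal_aff_prime K α Bτ
  have hα : α ∈ aff K α Bτ := ⟨0, Submodule.zero_mem _, by simp⟩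
  constructor
  · intro hnot
    refine ⟨?_, ?_⟩
    · rintro F hF hsub ⟨s, hs, hαs⟩
      by_contra hcon
      apply hnot
      intro f hf
      have hs' : F s ∈ F '' S := by rw [hset.sameF F hF]; exact ⟨s, hs, rfl⟩
      obtain ⟨x, hx, hxs⟩ := hs'
      have hd : f ∈ vIdeal K (aff K (toK K x) (facetSet A F)) := by
        apply dense_S K hset (Finset.filter_subset _ _) hx
        intro n hn hxn
        rw [mem_vIdeal] at hf
        refine hf _ ⟨x + n, ⟨hxn, ?_⟩, rfl⟩
        intro hmem
        have hmem' : a + (x + n) ∈ Sc := by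
          have h1 : a + (x + n) ∈ S := hmem
          rw [hset.expr] at h1
          exact h1.1
        apply hcon
        refine ⟨_, hmem', ?_⟩
        have hFn : F n = 0 := by
          have h1 := FK_spanK K (G := F) (fun c hc => (Finset.mem_filter.1 hc).2)
            (toK_mem_spanK K (NA_le_closure _ hn))
          rw [FK_toK] at h1
          exact_mod_cast h1
        rw [← FKl_apply, map_add, FKl_apply, FKl_apply, FK_toK, hαs, map_add, map_add, hFn, hxs]
        push_cast; ring
      rw [mem_vIdeal] at hd ⊢
      rintro _ ⟨l, hl, rfl⟩
      apply hd
      refine ⟨α + l - toK K x, ?_, by abel⟩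
      rw [spanK_facet K hF, LinearMap.mem_ker, map_sub, map_add, FKl_apply, FKl_apply, FKl_apply,
        FK_toK, hαs, hxs,
        FK_spanK K (G := F) (fun c hc => (Finset.mem_filter.1 (hsub hc)).2) hl]
      ring
    · rintro i hsub hmem ⟨x, hx, z, hz, hxz⟩
      apply hnot
      intro f hf
      have hd : f ∈ vIdeal K (aff K (toK K x) (Bf i)) := by
        obtain ⟨G, hGA, -⟩ := hset.face i
        apply dense_S K hset hGA hx
        intro n hn hxn
        rw [mem_vIdeal] at hf
        refine hf _ ⟨x + n, ⟨hxn, ?_⟩, rfl⟩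
        intro h1
        have h1 : a + (x + n) ∈ S := h1
        rw [hset.expr] at h1
        apply h1.2
        rw [Set.mem_iUnion]
        refine ⟨i, ?_⟩
        show a + (x + n) - b i ∈ AddSubgroup.closure (Bf i : Set (Zd d))
        have h2 : a + (x + n) - b i = n - z := by
          have h3 : b i = x + z + a := by rw [← hxz]; abel
          rw [h3]; abel
        rw [h2]
        exact AddSubgroup.sub_mem _ (NA_le_closure _ hn) hz
      rw [mem_vIdeal] at hd ⊢
      rintro _ ⟨l, hl, rfl⟩
      apply hd
      refine ⟨α + l - toK K x, ?_, by abel⟩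
      have hl' : l ∈ spanK K (Bf i) :=
        Submodule.span_mono (Set.image_mono (by exact_mod_cast hsub)) hl
      have h3 : toK K x = toK K (b i) - toK K a - toK K z := by
        rw [← toK_sub, hxz, toK_add]; abel
      have h4 : α + l - toK K x = (α + toK K a - toK K (b i)) + l + toK K z := by
        rw [h3]; abel
      rw [h4]
      exact Submodule.add_mem _ (Submodule.add_mem _ hmem hl') (toK_mem_spanK K hz)
  · rintro ⟨h1, h2⟩ hle
    have hfac := facets_finite hset.latt
    have hbad : ∀ F : Zd d →+ ℤ, ∃ T : Finset ℤ, IsFacetFn A F →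
        ∀ k, k ∈ T ↔ k ∈ F '' Sc ∧ k + F a ∉ F '' Sc := by
      intro F
      by_cases hF : IsFacetFn A F
      · exact ⟨(bad_finite hset.latt hset.fg hF (F a)).toFinset, fun _ k => by simp⟩
      · exact ⟨∅, fun h => absurd h hF⟩
    choose T hT using hbad
    have hg : ∀ i, ∃ g : MvPolynomial (Fin d) K, g ∉ vIdeal K (aff K α Bτ) ∧
        (b i - a ∈ plusZ S (Bf i) → ∀ v, v - toK K (b i - a) ∈ spanK K (Bf i) →
          MvPolynomial.eval v g = 0) := by
      intro i
      by_cases hi : b i - a ∈ plusZ S (Bf i)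
      · have : ∃ p ∈ aff K α Bτ, p - toK K (b i - a) ∉ spanK K (Bf i) := by
          by_contra! hall
          have e0 := hall α hα
          have hsub : Bτ ⊆ Bf i := by
            intro c hc
            have e1 := hall (α + toK K c) ⟨_, Submodule.subset_span ⟨c, hc, rfl⟩, rfl⟩
            have e2 := Submodule.sub_mem _ e1 e0
            have e3 : α + toK K c - toK K (b i - a) - (α - toK K (b i - a)) = toK K c := by abel
            rw [e3] at e2
            obtain ⟨G, hGA, -, hG0⟩ := hset.face i
            have e4 := FK_spanK K (G := G) (fun c hc => (hG0 c (hGA hc)).2 hc) e2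
            rw [FK_toK] at e4
            obtain ⟨_, hτA, -⟩ := hτ
            exact (hG0 c (hτA hc)).1 (by exact_mod_cast e4)
          refine h2 i hsub ?_ hi
          have e5 : α + toK K a - toK K (b i) = α - toK K (b i - a) := by
            rw [toK_sub]; abel
          rw [e5]; exact e0
        obtain ⟨p, hp, hpn⟩ := this
        obtain ⟨l, hl, hker⟩ := Submodule.exists_le_ker_of_notMem hpn
        refine ⟨linPoly K l (l (toK K (b i - a))), ?_, ?_⟩
        · intro hmem
          rw [mem_vIdeal] at hmem
          have := hmem p hp
          rw [eval_linPoly, ← map_sub] at this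
          exact hl this
        · intro _ v hv
          rw [eval_linPoly, ← map_sub]
          exact hker hv
      · exact ⟨1, fun h => hP.ne_top ((Ideal.eq_top_iff_one _).2 h), fun h => absurd h hi⟩
    choose g hgn hg0 using hg
    set f1 : MvPolynomial (Fin d) K :=
      ∏ F ∈ hfac.toFinset, ∏ k ∈ T F, linPoly K (FKl K F) (k : K) with hf1
    have hf : f1 * ∏ i, g i ∈ vIdeal K (toK K '' Omega S S a) := by
      rw [mem_vIdeal]
      rintro _ ⟨x, ⟨hx, hxa⟩, rfl⟩
      have hxa : a + x ∉ S := hxa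
      have hxc : x ∈ Sc := by rw [hset.expr] at hx; exact hx.1
      rw [map_mul]
      by_cases hc : a + x ∈ Sc
      · rw [hset.expr] at hxa
        simp only [Set.mem_diff, hc, true_and, not_not, Set.mem_iUnion] at hxa
        obtain ⟨i, hi⟩ := hxa
        have hi : a + x - b i ∈ AddSubgroup.closure (Bf i : Set (Zd d)) := hi
        suffices hz : MvPolynomial.eval (toK K x) (g i) = 0 by
          rw [map_prod (MvPolynomial.eval (toK K x)) g,
            Finset.prod_eq_zero (Finset.mem_univ i) hz, mul_zero]
        apply hg0
        · exact ⟨x, hx, -(a + x - b i), AddSubgroup.neg_mem _ hi, by abel⟩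
        · rw [← toK_sub]
          apply toK_mem_spanK
          have : x - (b i - a) = a + x - b i := by abel
          rw [this]; exact hi
      · have hsc := hset.scored
        have hc' := hc
        rw [hsc] at hc'
        simp only [Set.mem_setOf_eq, not_forall] at hc'
        obtain ⟨F, hF, hFx⟩ := hc'
        rw [hf1, map_prod, Finset.prod_eq_zero (i := F) (by simpa using hF), zero_mul]
        rw [map_prod]
        apply Finset.prod_eq_zero (i := F x)
        · rw [hT F hF]
          refine ⟨⟨x, hxc, rfl⟩, ?_⟩
          rw [← map_add, add_comm]; exact hFx
        · rw [eval_linPoly, FKl_apply, FK_toK, sub_self]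
    rcases hP.mem_or_mem (hle hf) with hm | hm
    · rw [hf1, Ideal.IsPrime.prod_mem_iff] at hm
      obtain ⟨F, hF, hm⟩ := hm
      have hF : IsFacetFn A F := by simpa using hF
      rw [Ideal.IsPrime.prod_mem_iff] at hm
      obtain ⟨k, hk, hm⟩ := hm
      rw [hT F hF] at hk
      obtain ⟨⟨s, hs, rfl⟩, hk⟩ := hk
      rw [mem_vIdeal] at hm
      have e0 := hm α hα
      rw [eval_linPoly] at e0
      have hsub : Bτ ⊆ facetSet A F := by
        intro c hc
        have e1 := hm (α + toK K c) ⟨_, Submodule.subset_span ⟨c, hc, rfl⟩, rfl⟩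
        rw [eval_linPoly, map_add, FKl_apply K F (toK K c), FK_toK] at e1
        have e2 : ((F c : ℤ) : K) = 0 := by linear_combination e1 - e0
        obtain ⟨_, hτA, -⟩ := hτ
        exact Finset.mem_filter.2 ⟨hτA hc, by exact_mod_cast e2⟩
      obtain ⟨s', hs', e3⟩ := h1 F hF hsub ⟨s, hs, sub_eq_zero.1 e0⟩
      apply hk
      refine ⟨s', hs', ?_⟩
      rw [← FKl_apply, map_add, FKl_apply K F (toK K a), FK_toK, sub_eq_zero.1 e0] at e3
      exact_mod_cast e3.symm
    · rw [Ideal.IsPrime.prod_mem_iff] at hm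
      obtain ⟨i, -, hm⟩ := hm
      exact hgn i hm

end SaitoTakahashi
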